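/- Let U be any uniform covering of SL(2,ℝ) with associated metric d_U. Then: (i) for every k ≥ 2 there is no quasi-isometric embedding from (ℝᵏ, d_{U(ℝᵏ)}) to (SL(2,ℝ), d_U), where U(ℝᵏ) is the uniform covering of ℝᵏ; (ii) for every n ≥ 1 there is no quasi-isometric embedding from (ℝ^{2n+1}, d_{P_n}) to (SL(2,ℝ), d_U), where P_n is the Heisenberg covering; and (iii) (ℝ, d_{U(ℝ)}) is not quasi-isometric to (SL(2,ℝ), d_U). -/

import Mathlib

open Set Pointwise MeasureTheory
open scoped Classical

/-- A `Q`-chain of length `k` from `x` to `y`: a sequence `Q_{i₁}, …, Q_{i_k}` of members of the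
covering with `x ∈ Q_{i₁}`, `y ∈ Q_{i_k}` and consecutive members intersecting. -/
def ChainExists {X I : Type*} (Q : I → Set X) (k : ℕ) (x y : X) : Prop :=
  ∃ (hk : 0 < k) (c : Fin k → I),
    x ∈ Q (c ⟨0, hk⟩) ∧ y ∈ Q (c ⟨k - 1, Nat.sub_lt hk Nat.one_pos⟩) ∧
      ∀ (l : ℕ) (h : l + 1 < k),
        (Q (c ⟨l, by omega⟩) ∩ Q (c ⟨l + 1, h⟩)).Nonempty

/-- An admissible covering: a family of nonempty sets covering `X` such that the number of
neighbours of each member is uniformly bounded. -/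
def IsAdmissibleCovering {X I : Type*} (Q : I → Set X) : Prop :=
  (∀ i, (Q i).Nonempty) ∧ (⋃ i, Q i) = Set.univ ∧
    ∃ N : ℕ, ∀ i, {j | (Q i ∩ Q j).Nonempty}.Finite ∧ {j | (Q i ∩ Q j).Nonempty}.ncard ≤ N

/-- A concatenation: an admissible covering in which any two points are joined by a chain. -/
def IsConcatenation {X I : Type*} (Q : I → Set X) : Prop :=
  IsAdmissibleCovering Q ∧ ∀ x y : X, ∃ k : ℕ, ChainExists Q k x y

/-- The associated metric `d_Q` of a covered space `(X, Q)`. -/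
noncomputable def coveredDist {X I : Type*} (Q : I → Set X) (x y : X) : ℝ :=
  if x = y then 0 else ((sInf {k : ℕ | ChainExists Q k x y} : ℕ) : ℝ)

/-- Quasi-isometric embedding between (abstract) metric spaces. -/
def IsQIEmbedding {X Z : Type*} (dX : X → X → ℝ) (dZ : Z → Z → ℝ) (f : X → Z) : Prop :=
  ∃ L C : ℝ, 0 < L ∧ 0 < C ∧ ∀ x y : X,
    (1 / L) * dX x y - C ≤ dZ (f x) (f y) ∧ dZ (f x) (f y) ≤ L * dX x y + C

/-- Quasi-isometry: a quasi-isometric embedding whose image is a net. -/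
def IsQuasiIsometry {X Z : Type*} (dX : X → X → ℝ) (dZ : Z → Z → ℝ) (f : X → Z) : Prop :=
  IsQIEmbedding dX dZ f ∧ ∃ M : ℝ, 0 < M ∧ ∀ z : Z, ∃ x : X, dZ z (f x) ≤ M

/-- The iterated neighbourhood `P_j^{k*}` of a member of a covering. -/
def starSet {X J : Type*} (P : J → Set X) (j : J) : ℕ → Set X
  | 0 => P j
  | k + 1 => ⋃ l ∈ {l | (P l ∩ starSet P j k).Nonempty}, P l

/-- `Q` is almost subordinate to `P`. -/
def AlmostSubordinate {X I J : Type*} (Q : I → Set X) (P : J → Set X) : Prop :=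
  ∃ k : ℕ, ∀ i : I, ∃ j : J, Q i ⊆ starSet P j k

/-- Two coverings of the same set are equivalent if each is almost subordinate to the other. -/
def EquivalentCoverings {X I J : Type*} (Q : I → Set X) (P : J → Set X) : Prop :=
  AlmostSubordinate Q P ∧ AlmostSubordinate P Q

/-- The word metric associated to a generating set `S` of a group. -/
noncomputable def wordDist {G : Type*} [Group G] (S : Set G) (g h : G) : ℝ :=
  ((sInf {n : ℕ | ∃ w : Fin n → G, (∀ i, w i ∈ S) ∧ g⁻¹ * h = (List.ofFn w).prod} : ℕ) : ℝ)

/-- The uniform covering of `ℝⁿ` by the integer translates of the unit cube. -/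
def uniformCovering (n : ℕ) : (Fin n → ℤ) → Set (Fin n → ℝ) :=
  fun v => {x | ∀ i, (v i : ℝ) ≤ x i ∧ x i ≤ (v i : ℝ) + 1}

/-- The dyadic covering of `ℝⁿ` (with the Euclidean norm). -/
def dyadicCovering (n : ℕ) : ℕ → Set (EuclideanSpace ℝ (Fin n)) :=
  fun m => if m = 0 then {x | ‖x‖ ≤ 2}
           else {x | (2 : ℝ) ^ (m - 1) ≤ ‖x‖ ∧ ‖x‖ ≤ (2 : ℝ) ^ (m + 1)}

/-- A uniform covering of a topological group: an admissible covering by left translates of a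
nonempty, open, symmetric, precompact reference set. -/
def IsUniformCovering {G : Type*} [Group G] [TopologicalSpace G] {I : Type*}
    (U : I → Set G) : Prop :=
  IsAdmissibleCovering U ∧
    ∃ (Q₀ : Set G) (g : I → G), Q₀.Nonempty ∧ IsOpen Q₀ ∧ Q₀⁻¹ = Q₀ ∧
      IsCompact (closure Q₀) ∧ ∀ i, U i = g i • Q₀

/-- The underlying space `ℝ^{2n+1} = ℝⁿ × ℝⁿ × ℝ` of the Heisenberg group. -/
abbrev HeisReal (n : ℕ) : Type := (Fin n → ℝ) × (Fin n → ℝ) × ℝ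

/-- The integer points `ℤ^{2n+1}`, underlying the discrete Heisenberg group. -/
abbrev HeisInt (n : ℕ) : Type := (Fin n → ℤ) × (Fin n → ℤ) × ℤ

/-- The Heisenberg product `(a,b,c) * (a',b',c') = (a+a', b+b', c+c'+a·b')` on `ℝ^{2n+1}`. -/
def heisMul {n : ℕ} (p q : HeisReal n) : HeisReal n :=
  (p.1 + q.1, p.2.1 + q.2.1, p.2.2 + q.2.2 + ∑ i, p.1 i * q.2.1 i)

/-- The Heisenberg product on `ℤ^{2n+1}`, making it the discrete Heisenberg group
`ℍ_{2n+1}(ℤ)`. -/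
def heisMulZ {n : ℕ} (p q : HeisInt n) : HeisInt n :=
  (p.1 + q.1, p.2.1 + q.2.1, p.2.2 + q.2.2 + ∑ i, p.1 i * q.2.1 i)

/-- The inclusion `ℤ^{2n+1} ⊆ ℝ^{2n+1}`. -/
def heisEmbed {n : ℕ} (γ : HeisInt n) : HeisReal n :=
  (fun i => (γ.1 i : ℝ), fun i => (γ.2.1 i : ℝ), (γ.2.2 : ℝ))

/-- The unit cube `[0,1]^{2n+1}` in `ℝ^{2n+1}`. -/
def heisCube (n : ℕ) : Set (HeisReal n) :=
  {p | (∀ i, p.1 i ∈ Set.Icc (0 : ℝ) 1) ∧ (∀ i, p.2.1 i ∈ Set.Icc (0 : ℝ) 1) ∧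
    p.2.2 ∈ Set.Icc (0 : ℝ) 1}

/-- The Heisenberg covering `P_n = (γ * [0,1]^{2n+1})_{γ ∈ ℤ^{2n+1}}` of `ℝ^{2n+1}`. -/
def heisCover (n : ℕ) : HeisInt n → Set (HeisReal n) :=
  fun γ => (fun x => heisMul (heisEmbed γ) x) '' heisCube n

/-- The uniform covering of `ℝ^{2n+1}` by additive integer translates of the unit cube. -/
def uniformCoverH (n : ℕ) : HeisInt n → Set (HeisReal n) :=
  fun γ => (fun x => heisEmbed γ + x) '' heisCube n

/-- `SL(2,ℝ)`. -/
abbrev SL2R : Type := Matrix.SpecialLinearGroup (Fin 2) ℝ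

/-- The topology of `SL(2,ℝ)` as a subspace of the `2 × 2` real matrices. -/
instance : TopologicalSpace SL2R :=
  inferInstanceAs (TopologicalSpace { A : Matrix (Fin 2) (Fin 2) ℝ // A.det = 1 })

/-- `γ` is a quasi-isometric embedding, with parameters `L, C`, of the interval `[0,a]`
into `(X,d)`. -/
def IsQIEmbOn {X : Type*} (d : X → X → ℝ) (L C a : ℝ) (γ : ℝ → X) : Prop :=
  ∀ s ∈ Set.Icc (0 : ℝ) a, ∀ t ∈ Set.Icc (0 : ℝ) a,
    (1 / L) * |s - t| - C ≤ d (γ s) (γ t) ∧ d (γ s) (γ t) ≤ L * |s - t| + C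

/-- The side `γ : [0,a] → X` lies in the `δ`-neighbourhood of the union of the two other sides
`γ₂ : [0,b] → X` and `γ₃ : [0,c] → X`. -/
def SideSlim {X : Type*} (d : X → X → ℝ) (δ a : ℝ) (γ : ℝ → X) (b c : ℝ)
    (γ₂ γ₃ : ℝ → X) : Prop :=
  ∀ t ∈ Set.Icc (0 : ℝ) a, ∃ s : ℝ,
    (s ∈ Set.Icc (0 : ℝ) b ∧ d (γ t) (γ₂ s) ≤ δ) ∨ (s ∈ Set.Icc (0 : ℝ) c ∧ d (γ t) (γ₃ s) ≤ δ)

/-- A (quasi-geodesic) metric space is quasi-hyperbolic if there are `L, C, δ > 0` such that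
every quasi-geodesic triangle with parameters `L' ≥ L`, `C' ≥ C` is `δ`-slim. -/
def IsQuasiHyperbolic {X : Type*} (d : X → X → ℝ) : Prop :=
  ∃ L C δ : ℝ, 0 < L ∧ 0 < C ∧ 0 < δ ∧
    ∀ L' C' : ℝ, L ≤ L' → C ≤ C' →
      ∀ (a₁ a₂ a₃ : ℝ) (γ₁ γ₂ γ₃ : ℝ → X),
        0 ≤ a₁ → 0 ≤ a₂ → 0 ≤ a₃ →
        IsQIEmbOn d L' C' a₁ γ₁ → IsQIEmbOn d L' C' a₂ γ₂ → IsQIEmbOn d L' C' a₃ γ₃ →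
        γ₁ a₁ = γ₂ 0 → γ₂ a₂ = γ₃ 0 → γ₃ a₃ = γ₁ 0 →
        SideSlim d δ a₁ γ₁ a₂ a₃ γ₂ γ₃ ∧ SideSlim d δ a₂ γ₂ a₃ a₁ γ₃ γ₁ ∧
          SideSlim d δ a₃ γ₃ a₁ a₂ γ₁ γ₂

/-- Twice the Gromov product of `x` and `y` with respect to the base point `w`. -/
noncomputable def doubleGromovProd {Y : Type*} [PseudoMetricSpace Y] (w x y : Y) : ℝ :=
  dist w x + dist w y - dist x y

/-- Gromov's four-point condition with constant `δ`. -/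
def FourPointCondition (Y : Type*) [PseudoMetricSpace Y] (δ : ℝ) : Prop :=
  ∀ x y z w : Y, dist x z + dist y w ≤
    max (dist x y + dist z w) (dist y z + dist x w) + δ

theorem FourPointCondition.min_le {Y : Type*} [PseudoMetricSpace Y] {δ : ℝ}
    (h : FourPointCondition Y δ) (w x y z : Y) :
    min (doubleGromovProd w x y) (doubleGromovProd w y z) ≤ doubleGromovProd w x z + δ := by
  have := h x y z w
  simp only [doubleGromovProd, dist_comm w]
  rcases le_total (dist x y + dist z w) (dist y z + dist x w) with h1 | h1
  · rw [max_eq_right h1] at this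
    exact (min_le_right _ _).trans (by linarith)
  · rw [max_eq_left h1] at this
    exact (min_le_left _ _).trans (by linarith)

/-- In a hyperbolic space the Gromov product of the ends of a discrete path of length at most
`2 ^ k` exceeds that of some consecutive pair up to an error linear in `k`. -/
theorem FourPointCondition.exists_consecutive {Y : Type*} [PseudoMetricSpace Y] {δ : ℝ}
    (h : FourPointCondition Y δ) (w : Y) (z : ℕ → Y) (k : ℕ) :
    ∀ a N : ℕ, 0 < N → N ≤ 2 ^ k → ∃ i, a ≤ i ∧ i < a + N ∧
      doubleGromovProd w (z i) (z (i + 1)) ≤ doubleGromovProd w (z a) (z (a + N)) + k * δ := by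
  induction k with
  | zero =>
    intro a N h0 h1
    obtain rfl : N = 1 := by simp at h1; omega
    exact ⟨a, le_rfl, by omega, by simp⟩
  | succ k ih =>
    intro a N h0 h1
    have hδ : 0 ≤ δ := by simpa using h w w w w
    by_cases hN : N ≤ 2 ^ k
    · obtain ⟨i, hi, hi', hi''⟩ := ih a N h0 hN
      exact ⟨i, hi, hi', hi''.trans (by push_cast; linarith)⟩
    · have hp : 0 < 2 ^ k := by positivity
      have hmin := h.min_le w (z a) (z (a + 2 ^ k)) (z (a + N))
      rcases min_le_iff.1 hmin with h2 | h2
      · obtain ⟨i, hi, hi', hi''⟩ := ih a (2 ^ k) hp le_rfl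
        exact ⟨i, hi, by omega, by push_cast; linarith⟩
      · obtain ⟨i, hi, hi', hi''⟩ := ih (a + 2 ^ k) (N - 2 ^ k) (by omega)
          (by rw [pow_succ] at h1; omega)
        rw [show a + 2 ^ k + (N - 2 ^ k) = a + N by omega] at hi''
        exact ⟨i, by omega, by omega, by push_cast; linarith⟩

/-- A discrete path of length at most `2 ^ k` in a hyperbolic space passes near each point `w`
lying on a geodesic between its ends. -/
theorem FourPointCondition.exists_dist_le {Y : Type*} [PseudoMetricSpace Y] {δ S : ℝ}
    (h : FourPointCondition Y δ) (w : Y) (z : ℕ → Y) {k N : ℕ} (hN : 0 < N) (hNk : N ≤ 2 ^ k)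
    (hS : ∀ i < N, dist (z i) (z (i + 1)) ≤ S)
    (hw : dist w (z 0) + dist w (z N) = dist (z 0) (z N)) :
    ∃ i < N, dist w (z i) ≤ k * δ + S := by
  obtain ⟨i, -, hi, h1⟩ := h.exists_consecutive w z k 0 N hN hNk
  simp only [zero_add] at hi h1
  have hδ : 0 ≤ k * δ := mul_nonneg k.cast_nonneg (by simpa using h w w w w)
  refine ⟨i, hi, ?_⟩
  have h2 := hS i hi
  have h3 := dist_triangle w (z (i + 1)) (z i)
  rw [dist_comm (z (i + 1))] at h3
  simp only [doubleGromovProd, hw, sub_self, zero_add] at h1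
  linarith

theorem dist_grid_le {Y : Type*} [PseudoMetricSpace Y] {S : ℝ} (ψ : ℕ → Y)
    (h : ∀ s, dist (ψ s) (ψ (s + 1)) ≤ S) (s m : ℕ) : dist (ψ s) (ψ (s + m)) ≤ m * S := by
  induction m with
  | zero => simp
  | succ m ih =>
    refine (dist_triangle _ (ψ (s + m)) _).trans ?_
    rw [← add_assoc]
    push_cast
    linarith [h (s + m)]

/-- A polynomial of degree at most three is eventually dominated by `2 ^ j`. -/
theorem exists_mul_add_pow_lt_two_pow (a b c : ℝ) :
    ∃ j : ℕ, c * (a * j + b) ^ 2 + (a * j + b) < 2 ^ j := by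
  have h1 : (fun j : ℕ => ((j : ℝ) ^ 2)) =o[Filter.atTop] fun j => (2 : ℝ) ^ j :=
    isLittleO_pow_const_const_pow_of_one_lt 2 (by norm_num)
  have h2 : (fun j : ℕ => ((j : ℝ) ^ 1)) =o[Filter.atTop] fun j => (2 : ℝ) ^ j :=
    isLittleO_pow_const_const_pow_of_one_lt 1 (by norm_num)
  have h3 : (fun j : ℕ => ((j : ℝ) ^ 0)) =o[Filter.atTop] fun j => (2 : ℝ) ^ j :=
    isLittleO_pow_const_const_pow_of_one_lt 0 (by norm_num)
  have h := ((h1.const_mul_left (c * a ^ 2)).add (h2.const_mul_left (2 * c * a * b + a))).add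
    (h3.const_mul_left (c * b ^ 2 + b))
  obtain ⟨j, hj⟩ := (h.bound (show (0 : ℝ) < 1 / 2 by norm_num)).exists
  refine ⟨j, ?_⟩
  have hp : (0 : ℝ) < 2 ^ j := by positivity
  rw [Real.norm_eq_abs, Real.norm_of_nonneg hp.le] at hj
  have := (le_abs_self _).trans hj
  nlinarith

/-- A hyperbolic space with midpoints contains no quasi-isometrically embedded copy of a quadrant
whose second direction is snowflaked. -/
theorem FourPointCondition.not_snowflaked_grid {Y : Type*} [PseudoMetricSpace Y] {δ : ℝ}
    (h : FourPointCondition Y δ)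
    (hmid : ∀ p q : Y, ∃ w, dist w p = dist p q / 2 ∧ dist w q = dist p q / 2)
    (ψ : ℕ → ℕ → Y) (S A : ℝ) (hS₁ : ∀ s t, dist (ψ s t) (ψ (s + 1) t) ≤ S)
    (hS₂ : ∀ s t, dist (ψ s t) (ψ s (t + 1)) ≤ S) (hA : 0 < A)
    (hlow₁ : ∀ s t s' t' : ℕ, |(s : ℝ) - s'| ≤ A * (dist (ψ s t) (ψ s' t') + 1))
    (hlow₂ : ∀ s t s' t' : ℕ, |(t : ℝ) - t'| ≤ (A * (dist (ψ s t) (ψ s' t') + 1)) ^ 2) : False := by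
  have hδ : 0 ≤ δ := by
    have := h (ψ 0 0) (ψ 0 0) (ψ 0 0) (ψ 0 0)
    simpa using this
  have hS : 0 ≤ S := dist_nonneg.trans (hS₁ 0 0)
  -- `E j = (2 j + 1) δ + S` and `R j = A (2 E j + 1)`
  obtain ⟨j, hj⟩ := exists_mul_add_pow_lt_two_pow (A * 4 * δ) (A * (2 * (δ + S) + 1)) (2 * A * S)
  set n : ℕ := 2 ^ j with hn
  have hn0 : 0 < n := by positivity
  set E : ℝ := (2 * j + 1 : ℕ) * δ + S with hE
  set R : ℝ := A * (2 * E + 1) with hR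
  have hE0 : 0 ≤ E := by positivity
  have hR0 : 0 ≤ R := by positivity
  have hjR : 2 * A * S * R ^ 2 + R < n := by
    convert! hj using 1
    · rw [hR, hE]; push_cast; ring
    · rw [hn]; push_cast; rfl
  have hRn : R < n := by
    have : 0 ≤ 2 * A * S * R ^ 2 := by positivity
    linarith
  have hn1 : (1 : ℝ) ≤ n := by exact_mod_cast hn0
  have hRn2 : R ^ 2 < (n : ℝ) ^ 2 := by gcongr
  set N := n + n ^ 2 with hN
  have hNk : N ≤ 2 ^ (2 * j + 1) := by
    have : n ≤ n ^ 2 := Nat.le_self_pow two_ne_zero n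
    have h2 : 2 ^ (2 * j + 1) = 2 * n ^ 2 := by rw [hn]; ring
    omega
  have hN0 : 0 < N := by positivity
  set p := ψ 0 0 with hp
  set q := ψ n (n ^ 2) with hq
  have hpq : (n : ℝ) ≤ A * (dist p q + 1) := by simpa using hlow₁ 0 0 n (n ^ 2)
  obtain ⟨w, hwp, hwq⟩ := hmid p q
  obtain ⟨i, hi, hwi⟩ := h.exists_dist_le w (fun i => ψ (min i n) (i - n)) hN0 hNk (S := S)
    (by
      intro i hi
      rcases lt_or_ge i n with hin | hin
      · rw [show min i n = i by omega, show min (i + 1) n = i + 1 by omega,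
          show i + 1 - n = i - n by omega]
        exact hS₁ _ _
      · rw [show min i n = n by omega, show min (i + 1) n = n by omega,
          show i + 1 - n = i - n + 1 by omega]
        exact hS₂ _ _)
    (by
      have : dist w p + dist w q = dist p q := by rw [hwp, hwq]; ring
      simpa [hN, hp, hq] using this)
  obtain ⟨l, hl, hwl⟩ := h.exists_dist_le w (fun i => ψ (i - n ^ 2) (min i (n ^ 2))) hN0 hNk
    (S := S)
    (by
      intro i hi
      rcases lt_or_ge i (n ^ 2) with hin | hin
      · rw [show min i (n ^ 2) = i by omega, show min (i + 1) (n ^ 2) = i + 1 by omega,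
          show i + 1 - n ^ 2 = i - n ^ 2 by omega]
        exact hS₂ _ _
      · rw [show min i (n ^ 2) = n ^ 2 by omega, show min (i + 1) (n ^ 2) = n ^ 2 by omega,
          show i + 1 - n ^ 2 = i - n ^ 2 + 1 by omega]
        exact hS₁ _ _)
    (by
      have : dist w p + dist w q = dist p q := by rw [hwp, hwq]; ring
      simpa [hN, hp, hq] using this)
  change dist w (ψ (min i n) (i - n)) ≤ E at hwi
  change dist w (ψ (l - n ^ 2) (min l (n ^ 2))) ≤ E at hwl
  have hab : dist (ψ (min i n) (i - n)) (ψ (l - n ^ 2) (min l (n ^ 2))) ≤ 2 * E := by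
    linarith [dist_triangle_left (ψ (min i n) (i - n)) (ψ (l - n ^ 2) (min l (n ^ 2))) w]
  have h₁ : |((min i n : ℕ) : ℝ) - ((l - n ^ 2 : ℕ) : ℝ)| ≤ R :=
    (hlow₁ _ _ _ _).trans (by rw [hR]; gcongr)
  have h₂ : |((i - n : ℕ) : ℝ) - ((min l (n ^ 2) : ℕ) : ℝ)| ≤ R ^ 2 :=
    (hlow₂ _ _ _ _).trans (by rw [hR]; gcongr)
  -- the point on the first side is close to `p` or to `q`
  have key : ∀ m : ℕ, (m : ℝ) ≤ R ∨ (m : ℝ) ≤ R ^ 2 → ∀ r, dist w r = dist p q / 2 →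
      dist (ψ (min i n) (i - n)) r ≤ m * S → False := by
    intro m hm r hr hmr
    have h3 : dist p q / 2 ≤ E + m * S := by
      linarith [dist_triangle w (ψ (min i n) (i - n)) r]
    have h4 : (n : ℝ) ≤ A * (2 * E + 2 * m * S + 1) :=
      hpq.trans (by gcongr; linarith)
    have h5 : (n : ℝ) ≤ R + 2 * A * S * m := by rw [hR]; linarith
    have h6 : 2 * A * S * m ≤ 2 * A * S * R ^ 2 := by
      rcases hm with hm | hm
      · have : m ≤ (m : ℝ) ^ 2 := by exact_mod_cast Nat.le_self_pow two_ne_zero m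
        gcongr
        exact this.trans (by gcongr)
      · gcongr
    linarith
  rcases le_total i n with hin | hin <;> rcases le_total l (n ^ 2) with hln | hln
  · rw [Nat.sub_eq_zero_of_le hln, min_eq_left hin, Nat.cast_zero, sub_zero, Nat.abs_cast] at h₁
    refine key i (.inl h₁) p hwp ?_
    rw [Nat.sub_eq_zero_of_le hin, min_eq_left hin, dist_comm]
    simpa using dist_grid_le (fun s => ψ s 0) (fun s => hS₁ s 0) 0 i
  · rw [Nat.sub_eq_zero_of_le hin, min_eq_right hln, Nat.cast_zero, zero_sub, abs_neg,
      Nat.abs_cast] at h₂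
    push_cast at h₂
    linarith
  · rw [Nat.sub_eq_zero_of_le hln, min_eq_right hin, Nat.cast_zero, sub_zero, Nat.abs_cast] at h₁
    linarith
  · have hi2 : i - n ≤ n ^ 2 := by omega
    rw [min_eq_right hln, abs_sub_comm, ← Nat.cast_sub hi2, Nat.abs_cast] at h₂
    refine key _ (.inr h₂) q hwq ?_
    rw [min_eq_right hin]
    have := dist_grid_le (fun t => ψ n t) (fun t => hS₂ n t) (i - n) (n ^ 2 - (i - n))
    rwa [Nat.add_sub_cancel' hi2] at this

namespace UpperHalfPlane

/-- Ptolemy's inequality in the hyperbolic plane. -/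
theorem sinh_half_dist_mul_le (a b c d : ℍ) :
    Real.sinh (dist a c / 2) * Real.sinh (dist b d / 2) ≤
      Real.sinh (dist a b / 2) * Real.sinh (dist c d / 2) +
        Real.sinh (dist b c / 2) * Real.sinh (dist a d / 2) := by
  have h := EuclideanGeometry.mul_dist_le_mul_dist_add_mul_dist (a : ℂ) b c d
  simp only [sinh_half_dist, Real.sqrt_mul (im_pos _).le]
  have ha := Real.sqrt_pos.2 a.im_pos
  have hb := Real.sqrt_pos.2 b.im_pos
  have hc := Real.sqrt_pos.2 c.im_pos
  have hd := Real.sqrt_pos.2 d.im_pos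
  calc _ = dist (a : ℂ) c * dist (b : ℂ) d / (4 * √a.im * √b.im * √c.im * √d.im) := by
        field_simp; ring
    _ ≤ (dist (a : ℂ) b * dist (c : ℂ) d + dist (b : ℂ) c * dist (a : ℂ) d) /
        (4 * √a.im * √b.im * √c.im * √d.im) := by gcongr
    _ = _ := by field_simp; ring

/-- The hyperbolic plane is Gromov hyperbolic. -/
theorem fourPointCondition : FourPointCondition ℍ 12 := by
  intro x y z w
  rcases le_total (dist x z) 2 with h1 | h1
  · have h2 := dist_triangle4 y z x w
    rw [dist_comm z x] at h2
    linarith [le_max_right (dist x y + dist z w) (dist y z + dist x w)]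
  rcases le_total (dist y w) 2 with h2 | h2
  · have h3 := dist_triangle4 x y w z
    rw [dist_comm w z] at h3
    linarith [le_max_left (dist x y + dist z w) (dist y z + dist x w)]
  have lower : ∀ a : ℝ, 2 ≤ a → Real.exp (a / 2) ≤ 4 * Real.sinh (a / 2) := by
    intro a ha
    have h3 : Real.exp (-(a / 2)) ≤ 1 := Real.exp_le_one_iff.2 (by linarith)
    have h4 := Real.add_one_le_exp (a / 2)
    rw [Real.sinh_eq]
    linarith
  have upper : ∀ a : ℝ, Real.sinh (a / 2) ≤ Real.exp (a / 2) / 2 := by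
    intro a
    have := Real.exp_pos (-(a / 2))
    rw [Real.sinh_eq]
    linarith
  have pos : ∀ a b : ℍ, 0 ≤ Real.sinh (dist a b / 2) := fun a b =>
    Real.sinh_nonneg_iff.2 (by positivity)
  set M := max (dist x y + dist z w) (dist y z + dist x w) with hM
  have prod : ∀ a b c d : ℍ, dist a b + dist c d ≤ M →
      Real.sinh (dist a b / 2) * Real.sinh (dist c d / 2) ≤ Real.exp (M / 2) / 4 := by
    intro a b c d h
    calc _ ≤ Real.exp (dist a b / 2) / 2 * (Real.exp (dist c d / 2) / 2) :=
          mul_le_mul (upper _) (upper _) (pos _ _) (by positivity)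
      _ = Real.exp ((dist a b + dist c d) / 2) / 4 := by
          rw [add_div, Real.exp_add]; ring
      _ ≤ _ := by gcongr
  have h3 : Real.exp ((dist x z + dist y w) / 2) ≤ Real.exp (M / 2 + 3) := by
    calc _ = Real.exp (dist x z / 2) * Real.exp (dist y w / 2) := by rw [add_div, Real.exp_add]
      _ ≤ (4 * Real.sinh (dist x z / 2)) * (4 * Real.sinh (dist y w / 2)) :=
          mul_le_mul (lower _ h1) (lower _ h2) (by positivity) (by have := pos x z; positivity)
      _ ≤ 8 * Real.exp (M / 2) := by
          have := sinh_half_dist_mul_le x y z w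
          linarith [prod x y z w (le_max_left _ _), prod y z x w (le_max_right _ _)]
      _ ≤ _ := by
          have h8 : (8 : ℝ) ≤ Real.exp 3 := by
            have := Real.exp_one_gt_d9
            rw [show (3 : ℝ) = 1 + 1 + 1 by norm_num, Real.exp_add, Real.exp_add]
            nlinarith [mul_pos (Real.exp_pos 1) (Real.exp_pos 1)]
          rw [Real.exp_add, mul_comm]
          gcongr
  linarith [Real.exp_le_exp.1 h3]

/-- The midpoint formula from the hyperboloid model, in half-plane coordinates. -/
theorem exists_midpoint (p q : ℍ) : ∃ w : ℍ, dist w p = dist p q / 2 ∧ dist w q = dist p q / 2 := by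
  set c := Real.cosh (dist p q / 2) with hc
  have hc0 : 0 < c := Real.cosh_pos _
  have hp := p.im_pos
  have hq := q.im_pos
  have hc2 : 4 * p.im * q.im * c ^ 2 = (p.re - q.re) ^ 2 + (p.im + q.im) ^ 2 := by
    have h1 : Real.cosh (dist p q) = 2 * c ^ 2 - 1 := by
      have := Real.cosh_two_mul (dist p q / 2)
      rw [mul_div_cancel₀ _ two_ne_zero, Real.sinh_sq] at this
      rw [this, hc]; ring
    rw [cosh_dist'] at h1
    field_simp at h1
    linarith
  set m : ℍ := ⟨⟨(p.re * q.im + q.re * p.im) / (p.im + q.im),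
    2 * p.im * q.im * c / (p.im + q.im)⟩, by positivity⟩ with hm
  have hre : m.re = (p.re * q.im + q.re * p.im) / (p.im + q.im) := rfl
  have him : m.im = 2 * p.im * q.im * c / (p.im + q.im) := rfl
  have inj : ∀ r : ℍ, Real.cosh (dist m r) = c → dist m r = dist p q / 2 := by
    intro r hr
    have := Real.cosh_strictMonoOn.injOn (x₁ := dist m r) (x₂ := dist p q / 2)
      dist_nonneg (by simp; positivity) (hr.trans hc)
    exact this
  refine ⟨m, inj p ?_, inj q ?_⟩
  · rw [cosh_dist', hre, him]
    have hx : (p.re - q.re) ^ 2 = 4 * p.im * q.im * c ^ 2 - (p.im + q.im) ^ 2 := by linarith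
    field_simp
    linear_combination (p.im ^ 2) * hx
  · rw [cosh_dist', hre, him]
    have hx : (p.re - q.re) ^ 2 = 4 * p.im * q.im * c ^ 2 - (p.im + q.im) ^ 2 := by linarith
    field_simp
    linear_combination (q.im ^ 2) * hx

theorem isPreconnected_closedBall (z : ℍ) (r : ℝ) : IsPreconnected (Metric.closedBall z r) := by
  rw [← isOpenEmbedding_coe.isInducing.isPreconnected_image, image_coe_closedBall]
  exact (convex_closedBall _ _).isPreconnected

end UpperHalfPlane

theorem chainExists_iff {X I : Type*} {Q : I → Set X} {k : ℕ} {x y : X} :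
    ChainExists Q k x y ↔ 0 < k ∧ ∃ p : ℕ → X, p 0 = x ∧ p k = y ∧
      ∀ l < k, ∃ i, p l ∈ Q i ∧ p (l + 1) ∈ Q i := by
  constructor
  · rintro ⟨hk, c, hx, hy, hc⟩
    choose z hz using hc
    refine ⟨hk, fun l => if h : 0 < l ∧ l < k then z (l - 1) (by omega) else if l = 0 then x else y,
      by simp, by simp [hk.ne'], fun l hl => ⟨c ⟨l, hl⟩, ?_, ?_⟩⟩
    · rcases Nat.eq_zero_or_pos l with rfl | h0
      · simpa using hx
      · have h := (hz (l - 1) (by omega)).2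
        simp only [h0, hl, and_self, dite_true]
        convert h using 3
        exact Fin.ext (by simp; omega)
    · rcases Nat.lt_or_ge (l + 1) k with h1 | h1
      · simpa [h1] using (hz l h1).1
      · have : ¬ l + 1 < k := by omega
        simp only [Nat.succ_pos, this, and_false, dite_false, Nat.succ_ne_zero, if_false]
        convert hy using 3
        exact Fin.ext (by simp; omega)
  · rintro ⟨hk, p, rfl, rfl, hp⟩
    choose c hc using hp
    refine ⟨hk, fun l => c l l.2, (hc 0 hk).1, ?_, fun l h => ⟨p (l + 1), ?_, ?_⟩⟩
    · have := (hc (k - 1) (by omega)).2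
      rwa [Nat.sub_add_cancel hk] at this
    · exact (hc l (by omega)).2
    · exact (hc (l + 1) h).1

theorem chainExists_one {X I : Type*} {Q : I → Set X} {x y : X} (i : I) (hx : x ∈ Q i)
    (hy : y ∈ Q i) : ChainExists Q 1 x y :=
  ⟨one_pos, fun _ => i, hx, hy, fun l h => by omega⟩

theorem ChainExists.symm {X I : Type*} {Q : I → Set X} {k : ℕ} {x y : X}
    (h : ChainExists Q k x y) : ChainExists Q k y x := by
  rw [chainExists_iff] at h ⊢
  obtain ⟨hk, p, rfl, rfl, hp⟩ := h
  refine ⟨hk, fun l => p (k - l), by simp, by simp, fun l hl => ?_⟩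
  obtain ⟨i, hi⟩ := hp (k - (l + 1)) (by omega)
  rw [show k - (l + 1) + 1 = k - l by omega] at hi
  exact ⟨i, hi.2, hi.1⟩

theorem ChainExists.trans {X I : Type*} {Q : I → Set X} {k m : ℕ} {x y z : X}
    (h : ChainExists Q k x y) (h' : ChainExists Q m y z) : ChainExists Q (k + m) x z := by
  rw [chainExists_iff] at h h' ⊢
  obtain ⟨hk, p, rfl, rfl, hp⟩ := h
  obtain ⟨hm, q, hq, rfl, hq'⟩ := h'
  refine ⟨by omega, fun l => if l ≤ k then p l else q (l - k), by simp, ?_, fun l hl => ?_⟩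
  · simp [hm.ne']
  · rcases Nat.lt_or_ge l k with h1 | h1
    · simpa [h1, h1.le, Nat.succ_le_iff] using hp l h1
    · obtain ⟨i, hi⟩ := hq' (l - k) (by omega)
      rw [show l - k + 1 = l + 1 - k by omega] at hi
      have h2 : ¬ l + 1 ≤ k := by omega
      refine ⟨i, ?_, by simpa [h2] using hi.2⟩
      rcases h1.eq_or_lt with rfl | h1
      · simpa [hq] using hi.1
      · simpa [show ¬ l ≤ k by omega] using hi.1

theorem coveredDist_le {X I : Type*} {Q : I → Set X} {k : ℕ} {x y : X}
    (h : ChainExists Q k x y) : coveredDist Q x y ≤ k := by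
  unfold coveredDist
  split_ifs
  · positivity
  · exact_mod_cast Nat.sInf_le h

theorem exists_chainExists_le_coveredDist_add_one {X I : Type*} {Q : I → Set X} {x y : X}
    (h : ∃ k, ChainExists Q k x y) : ∃ k, ChainExists Q k x y ∧ (k : ℝ) ≤ coveredDist Q x y + 1 := by
  by_cases hxy : x = y
  · subst hxy
    obtain ⟨k, hk, c, hx, -⟩ := h
    exact ⟨1, chainExists_one _ hx hx, by simp [coveredDist]⟩
  · refine ⟨sInf {k | ChainExists Q k x y}, Nat.sInf_mem h, ?_⟩
    rw [coveredDist, if_neg hxy]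
    linarith

theorem coveredDist_eq_of_ne {X I : Type*} {Q : I → Set X} {x y : X}
    (h : ∃ k, ChainExists Q k x y) (hxy : x ≠ y) :
    ∃ k, ChainExists Q k x y ∧ (k : ℝ) = coveredDist Q x y :=
  ⟨sInf {k | ChainExists Q k x y}, Nat.sInf_mem h, by rw [coveredDist, if_neg hxy]⟩

/-- A connected set covered by finitely many open members of a covering is joined by chains of
bounded length. -/
theorem exists_chainExists_of_isPreconnected {X I : Type*} [TopologicalSpace X] {U : I → Set X}
    (hopen : ∀ i, IsOpen (U i)) (hcov : (⋃ i, U i) = Set.univ) {C : Set X}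
    (hC : IsPreconnected C) (J : Finset I) (hJ : ∀ i, (U i ∩ C).Nonempty → i ∈ J) {x y : X}
    (hx : x ∈ C) (hy : y ∈ C) : ∃ k ≤ J.card, ChainExists U k x y := by
  let G : SimpleGraph J := SimpleGraph.fromRel fun i j => (U i ∩ U j).Nonempty
  have hmem : ∀ z ∈ C, ∃ i : J, z ∈ U i := by
    intro z hz
    obtain ⟨i, hi⟩ := mem_iUnion.1 (hcov ▸ mem_univ z)
    exact ⟨⟨i, hJ i ⟨z, hi, hz⟩⟩, hi⟩
  obtain ⟨i₀, hi₀⟩ := hmem x hx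
  have hreach : ∃ j, G.Reachable i₀ j ∧ y ∈ U j := by
    by_contra! hcon
    obtain ⟨j₀, hj₀⟩ := hmem y hy
    obtain ⟨z, hz, hz₁, hz₂⟩ := hC (⋃ (j : J) (_ : G.Reachable i₀ j), U j)
      (⋃ (j : J) (_ : ¬ G.Reachable i₀ j), U j)
      (isOpen_iUnion fun j => isOpen_iUnion fun _ => hopen j)
      (isOpen_iUnion fun j => isOpen_iUnion fun _ => hopen j)
      (fun z hz => by
        obtain ⟨j, hj⟩ := hmem z hz
        by_cases h : G.Reachable i₀ j
        · exact .inl (mem_iUnion₂.2 ⟨j, h, hj⟩)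
        · exact .inr (mem_iUnion₂.2 ⟨j, h, hj⟩))
      ⟨x, hx, mem_iUnion₂.2 ⟨i₀, .refl _, hi₀⟩⟩
      ⟨y, hy, mem_iUnion₂.2 ⟨j₀, fun h => hcon j₀ h hj₀, hj₀⟩⟩
    obtain ⟨i, hi, hzi⟩ := mem_iUnion₂.1 hz₁
    obtain ⟨j, hj, hzj⟩ := mem_iUnion₂.1 hz₂
    have hij : i ≠ j := by rintro rfl; exact hj hi
    exact hj (hi.trans (SimpleGraph.Adj.reachable
      ((SimpleGraph.fromRel_adj _ _ _).2 ⟨hij, .inl ⟨z, hzi, hzj⟩⟩)))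
  obtain ⟨j, hj, hyj⟩ := hreach
  have hwalk : ∀ (i j : J) (p : G.Walk i j) (x y : X), x ∈ U i → y ∈ U j →
      ChainExists U (p.length + 1) x y := by
    intro i j p
    induction p with
    | nil => exact fun x y hx hy => chainExists_one _ hx hy
    | cons hadj p ih =>
      intro x y hx hy
      obtain ⟨z, hz, hz'⟩ : (U _ ∩ U _).Nonempty :=
        ((SimpleGraph.fromRel_adj _ _ _).1 hadj).2.elim id fun h => inter_comm (U _) _ ▸ h
      have := (chainExists_one _ hx hz).trans (ih z y hz' hy)
      rwa [add_comm 1] at this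
  obtain ⟨p, hp⟩ := hj.exists_isPath
  refine ⟨p.length + 1, ?_, hwalk _ _ p x y hi₀ hyj⟩
  simpa using hp.length_lt

/-- Only boundedly many members of a uniform covering meet a given translate of a compact set. -/
theorem IsUniformCovering.exists_finset {G I : Type*} [Group G] [TopologicalSpace G]
    [IsTopologicalGroup G] {U : I → Set G} (hU : IsUniformCovering U) {K : Set G}
    (hK : IsCompact K) : ∃ M : ℕ, ∀ x : G, ∃ J : Finset I, J.card ≤ M ∧
      ∀ i, (U i ∩ x • K).Nonempty → i ∈ J := by
  obtain ⟨⟨-, -, N, hN⟩, Q₀, g, ⟨q, hq⟩, hopen, -, hcpt, hUg⟩ := hU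
  have hnhds : (fun p : G × G => p.1⁻¹ * p.2 * q) ⁻¹' Q₀ ∈ nhds ((1 : G), (1 : G)) := by
    refine ContinuousAt.preimage_mem_nhds (by fun_prop) (hopen.mem_nhds (by simpa using hq))
  rw [nhds_prod_eq, Filter.mem_prod_same_iff] at hnhds
  obtain ⟨V, hV, hVV⟩ := hnhds
  have hK' : IsCompact (K * (closure Q₀)⁻¹) := hK.mul hcpt.inv
  obtain ⟨T, -, hT⟩ := hK'.elim_nhds_subcover (fun h => h • V)
    fun h _ => by simpa using smul_mem_nhds_smul h hV
  refine ⟨T.card * N, fun x => ?_⟩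
  have hclass : ∀ h : G, ∃ F : Finset I, F.card ≤ N ∧ ∀ i, x⁻¹ * g i ∈ h • V → i ∈ F := by
    intro h
    by_cases hne : ∃ i, x⁻¹ * g i ∈ h • V
    · obtain ⟨i, hi⟩ := hne
      refine ⟨(hN i).1.toFinset, ?_, fun j hj => ?_⟩
      · rw [← Set.ncard_eq_toFinset_card _ (hN i).1]
        exact (hN i).2
      · simp only [Finite.mem_toFinset, mem_ofPred_eq]
        rw [Set.mem_smul_set_iff_inv_smul_mem, smul_eq_mul] at hi hj
        refine ⟨g j * q, ?_, ?_⟩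
        · rw [hUg i, Set.mem_smul_set_iff_inv_smul_mem, smul_eq_mul]
          have := hVV (mk_mem_prod hi hj)
          simpa [mul_assoc] using this
        · rw [hUg j]
          exact smul_mem_smul_set hq
    · exact ⟨∅, by simp, fun i hi => (hne ⟨i, hi⟩).elim⟩
  choose F hF hF' using hclass
  refine ⟨T.biUnion F, Finset.card_biUnion_le_card_mul _ _ _ fun h _ => hF h, ?_⟩
  rintro i ⟨y, hy, hyK⟩
  rw [hUg i, Set.mem_smul_set_iff_inv_smul_mem, smul_eq_mul] at hy
  rw [Set.mem_smul_set_iff_inv_smul_mem, smul_eq_mul] at hyK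
  have hmem : x⁻¹ * g i ∈ K * (closure Q₀)⁻¹ := by
    refine ⟨_, hyK, ((g i)⁻¹ * y)⁻¹, ?_, by simp⟩
    simpa using subset_closure hy
  obtain ⟨h, hh, hi⟩ := mem_iUnion₂.1 (hT hmem)
  exact Finset.mem_biUnion.2 ⟨h, hh, hF' h i hi⟩

/-- Points of a uniform covering which differ by an element of a compact connected set are joined
by chains of bounded length. -/
theorem IsUniformCovering.exists_chainExists_le {G I : Type*} [Group G] [TopologicalSpace G]
    [IsTopologicalGroup G] {U : I → Set G} (hU : IsUniformCovering U) {K : Set G}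
    (hK : IsCompact K) (hK' : IsPreconnected K) (h1 : (1 : G) ∈ K) :
    ∃ M : ℕ, ∀ x y : G, x⁻¹ * y ∈ K → ∃ k ≤ M, ChainExists U k x y := by
  obtain ⟨M, hM⟩ := hU.exists_finset hK
  obtain ⟨⟨-, hcov, -⟩, Q₀, g, -, hopen, -, -, hUg⟩ := hU
  refine ⟨M, fun x y hxy => ?_⟩
  obtain ⟨J, hJ, hJ'⟩ := hM x
  obtain ⟨k, hk, hc⟩ := exists_chainExists_of_isPreconnected
    (fun i => by rw [hUg i]; exact hopen.smul (g i)) hcov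
    (hK'.image (fun z => x • z) (by fun_prop)) J hJ'
    (x := x) (y := y) ⟨1, h1, by simp⟩ ⟨_, hxy, by simp⟩
  exact ⟨k, hk.trans hJ, hc⟩

/-- Members of a uniform covering have uniformly bounded image in any metric space on which the
group acts continuously by isometries. -/
theorem IsUniformCovering.exists_dist_smul_le {G I Y : Type*} [Group G] [TopologicalSpace G]
    [IsTopologicalGroup G] [PseudoMetricSpace Y] [MulAction G Y] [IsIsometricSMul G Y]
    {U : I → Set G} (hU : IsUniformCovering U) (o : Y) (ho : Continuous fun g : G => g • o) :
    ∃ D : ℝ, 0 < D ∧ ∀ (k : ℕ) (x y : G), ChainExists U k x y → dist (x • o) (y • o) ≤ k * D := by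
  obtain ⟨-, Q₀, g, -, -, -, hcpt, hUg⟩ := hU
  obtain ⟨r, hr⟩ := (hcpt.image ho).isBounded.subset_closedBall o
  refine ⟨max 1 (2 * r), by positivity, fun k x y h => ?_⟩
  obtain ⟨-, p, rfl, rfl, hp⟩ := chainExists_iff.1 h
  have hstep : ∀ l < k, dist (p l • o) (p (l + 1) • o) ≤ max 1 (2 * r) := by
    intro l hl
    obtain ⟨i, h1, h2⟩ := hp l hl
    have key : ∀ z ∈ U i, dist (z • o) (g i • o) ≤ r := by
      intro z hz
      rw [hUg i] at hz
      obtain ⟨q, hq, rfl⟩ := hz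
      simp only [smul_eq_mul, mul_smul, dist_smul]
      exact hr ⟨q, subset_closure hq, rfl⟩
    refine le_max_of_le_right ?_
    linarith [dist_triangle_right (p l • o) (p (l + 1) • o) (g i • o), key _ h1, key _ h2]
  have := dist_le_range_sum_of_dist_le (f := fun l => p l • o) k (d := fun _ => max 1 (2 * r))
    (fun {l} hl => hstep l hl)
  simpa using this

section SL2R

open UpperHalfPlane

instance : IsTopologicalGroup SL2R :=
  Matrix.SpecialLinearGroup.topologicalGroup

theorem continuous_smul_I : Continuous fun g : SL2R => g • I :=
  isProperMap_smul_I.continuous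

/-- The rotation matrix of angle `θ`. -/
noncomputable def rotationMatrix (θ : ℝ) : SL2R :=
  ⟨!![Real.cos θ, -Real.sin θ; Real.sin θ, Real.cos θ], by
    rw [Matrix.det_fin_two_of]; nlinarith [Real.sin_sq_add_cos_sq θ]⟩

theorem continuous_rotationMatrix : Continuous rotationMatrix := by
  refine continuous_induced_rng.2 ?_
  change Continuous fun θ : ℝ =>
    (!![Real.cos θ, -Real.sin θ; Real.sin θ, Real.cos θ] : Matrix (Fin 2) (Fin 2) ℝ)
  fun_prop

theorem continuous_toSL2R_specialLinearGroup : Continuous fun z : ℍ => (toSL2R z : SL2R) :=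
  continuous_toSL2R

/-- The stabilizer of `I` consists of rotations. -/
theorem exists_rotationMatrix_eq {r : SL2R} (hr : r • I = I) :
    ∃ θ ∈ Icc (-Real.pi) Real.pi, r = rotationMatrix θ := by
  have h := congrArg ((↑) : ℍ → ℂ) hr
  rw [coe_specialLinearGroup_apply] at h
  have hden : ((r 1 0 : ℝ) : ℂ) * I + (r 1 1 : ℝ) ≠ 0 := denom_ne_zero (r : GL (Fin 2) ℝ) I
  replace h : ((r 0 0 : ℝ) : ℂ) * I + (r 0 1 : ℝ) = I * (((r 1 0 : ℝ) : ℂ) * I + (r 1 1 : ℝ)) :=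
    (div_eq_iff hden).1 h
  have hre := congrArg Complex.re h
  have him := congrArg Complex.im h
  simp at hre him
  have hdet := r.2
  rw [Matrix.det_fin_two] at hdet
  change r 0 0 * r 1 1 - r 0 1 * r 1 0 = 1 at hdet
  set z : ℂ := ⟨r 1 1, r 1 0⟩ with hz
  have hn : ‖z‖ = 1 := by
    rw [Complex.norm_eq_sqrt_sq_add_sq, Real.sqrt_eq_one, hz]
    rw [hre, him] at hdet
    linarith
  have hz0 : z ≠ 0 := by
    rw [← norm_pos_iff, hn]; exact one_pos
  have hcos : Real.cos z.arg = r 1 1 := by rw [Complex.cos_arg hz0, hn, div_one]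
  have hsin : Real.sin z.arg = r 1 0 := by rw [Complex.sin_arg, hn, div_one]
  refine ⟨z.arg, ⟨(Complex.neg_pi_lt_arg z).le, Complex.arg_le_pi z⟩, ?_⟩
  ext i j
  fin_cases i <;> fin_cases j <;> simp [rotationMatrix, hcos, hsin, hre, him]

theorem exists_isCompact_isPreconnected :
    ∃ K : Set SL2R, IsCompact K ∧ IsPreconnected K ∧ ∀ g : SL2R, dist (g • I) I ≤ 1 → g ∈ K := by
  have hcont : Continuous fun p : ℍ × ℝ => (toSL2R p.1 : SL2R) * rotationMatrix p.2 :=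
    (continuous_toSL2R_specialLinearGroup.comp continuous_fst).mul (continuous_rotationMatrix.comp continuous_snd)
  refine ⟨_, ((isCompact_closedBall I 1).prod (isCompact_Icc (a := -Real.pi)
    (b := Real.pi))).image hcont, ((isPreconnected_closedBall I 1).prod
    isPreconnected_Icc).image _ hcont.continuousOn, fun g hg => ?_⟩
  obtain ⟨θ, hθ, h⟩ := exists_rotationMatrix_eq (r := (toSL2R (g • I))⁻¹ * g) (by
    rw [mul_smul, inv_smul_eq_iff, toSL2R_smul_I])
  exact ⟨(g • I, θ), ⟨hg, hθ⟩, by simp [← h]⟩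

/-- Chain lengths are controlled by the distance in the hyperbolic plane. -/
theorem IsUniformCovering.exists_chainExists_two_pow {I' : Type*} {U : I' → Set SL2R}
    (hU : IsUniformCovering U) : ∃ M : ℕ, ∀ (n : ℕ) (x y : SL2R), dist (x • I) (y • I) ≤ 2 ^ n →
      ∃ k ≤ M * 2 ^ n, ChainExists U k x y := by
  obtain ⟨K, hK, hK', hmem⟩ := exists_isCompact_isPreconnected
  obtain ⟨M, hM⟩ := hU.exists_chainExists_le hK hK' (hmem 1 (by simp))
  refine ⟨M, fun n => ?_⟩
  induction n with
  | zero =>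
    intro x y hxy
    obtain ⟨k, hk, h⟩ := hM x y (hmem _ (by
      rw [mul_smul, ← dist_smul x, smul_inv_smul, dist_comm]
      simpa using hxy))
    exact ⟨k, by simpa using hk, h⟩
  | succ n ih =>
    intro x y hxy
    obtain ⟨w, hw₁, hw₂⟩ := exists_midpoint (x • I) (y • I)
    rw [← toSL2R_smul_I w] at hw₁ hw₂
    rw [pow_succ] at hxy
    obtain ⟨k, hk, h⟩ := ih x (toSL2R w) (by rw [dist_comm, hw₁]; linarith)
    obtain ⟨l, hl, hwy⟩ := ih (toSL2R w) y (by rw [hw₂]; linarith)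
    exact ⟨k + l, by rw [pow_succ]; linarith, h.trans hwy⟩

/-- The metric of a uniform covering of `SL(2, ℝ)` is quasi-isometric to the hyperbolic metric. -/
theorem IsUniformCovering.exists_coveredDist_bounds {I' : Type*} {U : I' → Set SL2R}
    (hU : IsUniformCovering U) : ∃ D : ℝ, 0 < D ∧ ∀ x y : SL2R,
      dist (x • I) (y • I) ≤ D * coveredDist U x y ∧
      coveredDist U x y ≤ D * (dist (x • I) (y • I) + 1) := by
  obtain ⟨D, hD, hDist⟩ := hU.exists_dist_smul_le I continuous_smul_I
  obtain ⟨M, hM⟩ := hU.exists_chainExists_two_pow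
  have hnear : ∀ x y : SL2R, ∃ n : ℕ, dist (x • I) (y • I) ≤ 2 ^ n ∧
      (2 : ℝ) ^ n ≤ 2 * (dist (x • I) (y • I) + 1) := by
    intro x y
    obtain ⟨n, hn, hn'⟩ := exists_nat_pow_near (x := dist (x • I) (y • I) + 1) (y := (2 : ℝ))
      (by linarith [dist_nonneg (x := x • I) (y := y • I)]) one_lt_two
    exact ⟨n + 1, by linarith, by rw [pow_succ]; linarith⟩
  refine ⟨max D (2 * M), by positivity, fun x y => ⟨?_, ?_⟩⟩
  · by_cases hxy : x = y
    · simp [hxy, coveredDist]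
    obtain ⟨n, hn, -⟩ := hnear x y
    obtain ⟨l, -, hl⟩ := hM n x y hn
    obtain ⟨k, hk, hk'⟩ := coveredDist_eq_of_ne ⟨l, hl⟩ hxy
    rw [← hk', mul_comm]
    exact (hDist k x y hk).trans (by gcongr; exact le_max_left _ _)
  · obtain ⟨n, hn, hn'⟩ := hnear x y
    obtain ⟨k, hk, hc⟩ := hM n x y hn
    calc coveredDist U x y ≤ k := coveredDist_le hc
      _ ≤ M * 2 ^ n := by exact_mod_cast hk
      _ ≤ M * (2 * (dist (x • I) (y • I) + 1)) := by gcongr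
      _ = 2 * M * (dist (x • I) (y • I) + 1) := by ring
      _ ≤ _ := by gcongr; exact le_max_right _ _

end SL2R

section Obstructions

open UpperHalfPlane

theorem exists_chainExists_of_step {X I : Type*} {Q : I → Set X} {k : ℕ} {φ : ℕ → X}
    (h : ∀ s, ChainExists Q k (φ s) (φ (s + 1))) (s t : ℕ) :
    ∃ m, ChainExists Q m (φ s) (φ t) := by
  wlog hst : s ≤ t generalizing s t
  · obtain ⟨m, hm⟩ := this t s (by omega)
    exact ⟨m, hm.symm⟩
  induction t, hst using Nat.le_induction with
  | base => exact ⟨_, (h s).trans (h s).symm⟩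
  | succ t _ ih =>
    obtain ⟨m, hm⟩ := ih
    exact ⟨_, hm.trans (h t)⟩

/-- A covered space containing a quadrant, with the second direction at most quadratically
distorted, has no quasi-isometric embedding into `SL(2, ℝ)`. -/
theorem IsUniformCovering.not_isQIEmbedding {I₀ X J : Type*} {U : I₀ → Set SL2R}
    (hU : IsUniformCovering U) {Q : J → Set X} (φ : ℕ → ℕ → X)
    (hstep₁ : ∀ s t, ChainExists Q 1 (φ s t) (φ (s + 1) t))
    (hstep₂ : ∀ s t, ChainExists Q 1 (φ s t) (φ s (t + 1))) (B : ℝ) (hB : 1 ≤ B)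
    (hlow : ∀ k s t s' t' : ℕ, ChainExists Q k (φ s t) (φ s' t') →
      |(s : ℝ) - s'| ≤ k ∧ |(t : ℝ) - t'| ≤ B * k ^ 2) (f : X → SL2R) :
    ¬ IsQIEmbedding (coveredDist Q) (coveredDist U) f := by
  rintro ⟨L, C, hL, hC, hf⟩
  obtain ⟨D, hD, hDist⟩ := hU.exists_coveredDist_bounds
  have hstep : ∀ x y, ChainExists Q 1 x y → dist (f x • I) (f y • I) ≤ D * (L + C) := by
    intro x y h
    refine (hDist _ _).1.trans ?_
    have h1 := coveredDist_le h
    have h2 := (hf x y).2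
    push_cast at h1
    have h3 : L * coveredDist Q x y ≤ L * 1 := by gcongr
    gcongr
    linarith
  set A : ℝ := B * (L * (D + C) + 1) with hA
  have hA0 : 0 < A := by positivity
  have hchain : ∀ s t s' t' : ℕ, ∃ k, ChainExists Q k (φ s t) (φ s' t') ∧
      B * k ≤ A * (dist (f (φ s t) • I) (f (φ s' t') • I) + 1) := by
    intro s t s' t'
    obtain ⟨a, ha⟩ := exists_chainExists_of_step (fun s => hstep₁ s t) s s'
    obtain ⟨b, hb⟩ := exists_chainExists_of_step (fun t => hstep₂ s' t) t t'
    obtain ⟨k, hk, hk'⟩ := exists_chainExists_le_coveredDist_add_one ⟨_, ha.trans hb⟩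
    refine ⟨k, hk, ?_⟩
    set d := dist (f (φ s t) • I) (f (φ s' t') • I) with hd
    have hd0 : 0 ≤ d := dist_nonneg
    have h1 := (hf (φ s t) (φ s' t')).1
    have h2 := (hDist (f (φ s t)) (f (φ s' t'))).2
    have h3 : coveredDist Q (φ s t) (φ s' t') ≤ L * (D * (d + 1) + C) := by
      rw [← div_le_iff₀' hL]
      have : coveredDist Q (φ s t) (φ s' t') / L = 1 / L * coveredDist Q (φ s t) (φ s' t') := by
        ring
      linarith
    rw [hA, mul_assoc]
    gcongr
    have : 0 ≤ L * C * d := by positivity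
    nlinarith
  refine fourPointCondition.not_snowflaked_grid exists_midpoint (fun s t => f (φ s t) • I)
    (D * (L + C)) A (fun s t => hstep _ _ (hstep₁ s t)) (fun s t => hstep _ _ (hstep₂ s t)) hA0
    (fun s t s' t' => ?_) (fun s t s' t' => ?_)
  · obtain ⟨k, hk, hk'⟩ := hchain s t s' t'
    have : (k : ℝ) ≤ B * k := le_mul_of_one_le_left k.cast_nonneg hB
    exact (hlow k s t s' t' hk).1.trans (this.trans hk')
  · obtain ⟨k, hk, hk'⟩ := hchain s t s' t'
    refine (hlow k s t s' t' hk).2.trans ?_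
    calc B * (k : ℝ) ^ 2 ≤ B ^ 2 * k ^ 2 := by gcongr; exact le_self_pow₀ hB two_ne_zero
      _ = (B * k) ^ 2 := by ring
      _ ≤ _ := by gcongr

/-- Along a chain each step changes a function by at most `1`, if it does so on each member. -/
theorem ChainExists.abs_sub_le {X I : Type*} {Q : I → Set X} {k : ℕ} {x y : X}
    (h : ChainExists Q k x y) (u : X → ℝ) (hu : ∀ i, ∀ p ∈ Q i, ∀ q ∈ Q i, |u p - u q| ≤ 1) :
    |u x - u y| ≤ k := by
  obtain ⟨-, p, rfl, rfl, hp⟩ := chainExists_iff.1 h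
  have := dist_le_range_sum_of_dist_le (f := fun l => u (p l)) k (d := fun _ => 1)
    (fun {l} hl => by
      obtain ⟨i, h1, h2⟩ := hp l hl
      exact hu i _ h1 _ h2)
  simpa [Real.dist_eq] using this

theorem abs_sub_le_one_of_mem_uniformCovering {k : ℕ} (j : Fin k) (v : Fin k → ℤ)
    (p : Fin k → ℝ) (hp : p ∈ uniformCovering k v) (q : Fin k → ℝ)
    (hq : q ∈ uniformCovering k v) : |p j - q j| ≤ 1 := by
  have h1 := hp j
  have h2 := hq j
  rw [abs_le]
  constructor <;> linarith

theorem not_isQIEmbedding_uniformCovering {I₀ : Type*} {U : I₀ → Set SL2R}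
    (hU : IsUniformCovering U) {k : ℕ} (hk : 2 ≤ k) (f : (Fin k → ℝ) → SL2R) :
    ¬ IsQIEmbedding (coveredDist (uniformCovering k)) (coveredDist U) f := by
  have hij : (⟨1, by omega⟩ : Fin k) ≠ ⟨0, by omega⟩ := by simp
  set i : Fin k := ⟨0, by omega⟩
  set j : Fin k := ⟨1, by omega⟩
  refine hU.not_isQIEmbedding
    (fun s t l => if l = i then (s : ℝ) else if l = j then (t : ℝ) else 0)
    (fun s t => chainExists_one (fun l => if l = i then (s : ℤ) else if l = j then (t : ℤ) else 0)
      (fun l => ?_) (fun l => ?_))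
    (fun s t => chainExists_one (fun l => if l = i then (s : ℤ) else if l = j then (t : ℤ) else 0)
      (fun l => ?_) (fun l => ?_)) 1 le_rfl (fun m s t s' t' h => ⟨?_, ?_⟩) f
  any_goals dsimp only; split_ifs <;> simp
  · simpa using h.abs_sub_le (fun p => p i) (abs_sub_le_one_of_mem_uniformCovering i)
  · have h1 := h.abs_sub_le (fun p => p j) (abs_sub_le_one_of_mem_uniformCovering j)
    simp only [hij, if_false, if_true] at h1
    rw [one_mul]
    exact h1.trans (by exact_mod_cast Nat.le_self_pow two_ne_zero m)

theorem heisCover_sub_le {n : ℕ} {γ : HeisInt n} {p q : HeisReal n} (hp : p ∈ heisCover n γ)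
    (hq : q ∈ heisCover n γ) :
    (∀ i, |p.1 i - q.1 i| ≤ 1) ∧ ∀ a : Fin n → ℝ,
      |(p.2.2 - ∑ i, a i * p.2.1 i) - (q.2.2 - ∑ i, a i * q.2.1 i)| ≤
        1 + ∑ i, (|p.1 i - a i| + 1) := by
  obtain ⟨u, ⟨hu₁, hu₂, hu₃⟩, rfl⟩ := hp
  obtain ⟨v, ⟨hv₁, hv₂, hv₃⟩, rfl⟩ := hq
  simp only [heisMul, Pi.add_apply]
  refine ⟨fun i => ?_, fun a => ?_⟩
  · rw [abs_le]
    constructor <;> linarith [(hu₁ i).1, (hu₁ i).2, (hv₁ i).1, (hv₁ i).2]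
  · have h1 : |u.2.2 - v.2.2| ≤ 1 := by
      rw [abs_le]
      constructor <;> linarith [hu₃.1, hu₃.2, hv₃.1, hv₃.2]
    have h2 : ∀ i, |((heisEmbed γ).1 i - a i) * (u.2.1 i - v.2.1 i)| ≤
        |(heisEmbed γ).1 i + u.1 i - a i| + 1 := by
      intro i
      have h3 : |u.2.1 i - v.2.1 i| ≤ 1 := by
        rw [abs_le]
        constructor <;> linarith [(hu₂ i).1, (hu₂ i).2, (hv₂ i).1, (hv₂ i).2]
      have h4 : |(heisEmbed γ).1 i - a i| ≤ |(heisEmbed γ).1 i + u.1 i - a i| + 1 := by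
        have h5 : |u.1 i| ≤ 1 := by rw [abs_of_nonneg (hu₁ i).1]; exact (hu₁ i).2
        calc _ = |((heisEmbed γ).1 i + u.1 i - a i) - u.1 i| := by ring_nf
          _ ≤ _ := (abs_sub _ _).trans (by gcongr)
      rw [abs_mul]
      exact (mul_le_of_le_one_right (abs_nonneg _) h3).trans h4
    calc _ = |(u.2.2 - v.2.2) + ∑ i, ((heisEmbed γ).1 i - a i) * (u.2.1 i - v.2.1 i)| := by
          congr 1
          simp only [sub_mul, mul_sub, mul_add, Finset.sum_sub_distrib, Finset.sum_add_distrib]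
          ring
      _ ≤ _ := (abs_add_le _ _).trans
          (add_le_add h1 ((Finset.abs_sum_le_sum_abs _ _).trans (Finset.sum_le_sum fun i _ => h2 i)))

/-- The central coordinate is at most quadratically distorted along chains of the Heisenberg
covering. -/
theorem ChainExists.heisCover_le {n k : ℕ} {x y : HeisReal n}
    (h : ChainExists (heisCover n) k x y) :
    |(x.2.2 - ∑ i, x.1 i * x.2.1 i) - (y.2.2 - ∑ i, x.1 i * y.2.1 i)| ≤ (2 * n + 1) * k ^ 2 := by
  have h' := h
  obtain ⟨hk, p, rfl, rfl, hp⟩ := chainExists_iff.1 h'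
  have hpos : ∀ l, l ≤ k → ∀ i, |(p l).1 i - (p 0).1 i| ≤ l := by
    intro l
    induction l with
    | zero => simp
    | succ l ih =>
      intro hl i
      obtain ⟨γ, h1, h2⟩ := hp l (by omega)
      have h3 := (heisCover_sub_le h2 h1).1 i
      have h4 := ih (by omega) i
      push_cast
      linarith [_root_.abs_sub_le ((p (l + 1)).1 i) ((p l).1 i) ((p 0).1 i)]
  have := dist_le_range_sum_of_dist_le
    (f := fun l => (p l).2.2 - ∑ i, (p 0).1 i * (p l).2.1 i) k (d := fun _ => (2 * n + 1) * k)
    (fun {l} hl => by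
      obtain ⟨γ, h1, h2⟩ := hp l hl
      refine ((heisCover_sub_le h1 h2).2 (p 0).1).trans ?_
      have hk1 : (1 : ℝ) ≤ k := by exact_mod_cast hk
      have hlk : (l : ℝ) ≤ k := by exact_mod_cast hl.le
      calc _ ≤ (1 : ℝ) + ∑ _i : Fin n, ((k : ℝ) + k) := by
            gcongr with i
            exact (hpos l hl.le i).trans hlk
        _ = 1 + 2 * n * k := by simp; ring
        _ ≤ _ := by linarith)
  rw [Real.dist_eq] at this
  refine this.trans_eq ?_
  simp
  ring

theorem not_isQIEmbedding_heisCover {I₀ : Type*} {U : I₀ → Set SL2R}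
    (hU : IsUniformCovering U) {n : ℕ} (hn : 1 ≤ n) (f : HeisReal n → SL2R) :
    ¬ IsQIEmbedding (coveredDist (heisCover n)) (coveredDist U) f := by
  set i : Fin n := ⟨0, by omega⟩
  have hmem : ∀ (s t : ℕ) (u : Fin n → ℝ) (w : ℝ), (∀ l, u l ∈ Icc (0 : ℝ) 1) →
      w ∈ Icc (0 : ℝ) 1 → ((fun l => (if l = i then (s : ℝ) else 0) + u l, 0, t + w) : HeisReal n) ∈
        heisCover n (fun l => if l = i then (s : ℤ) else 0, 0, t) := by
    intro s t u w hu hw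
    refine ⟨(u, 0, w), ⟨hu, by simp, hw⟩, ?_⟩
    refine Prod.ext ?_ (Prod.ext ?_ ?_)
    · funext l
      simp only [heisMul, heisEmbed, Pi.add_apply]
      split_ifs <;> simp
    · funext l
      simp [heisMul, heisEmbed]
    · simp [heisMul, heisEmbed]
  have hbase : ∀ s t : ℕ, ((fun l => if l = i then (s : ℝ) else 0, 0, t) : HeisReal n) ∈
        heisCover n (fun l => if l = i then (s : ℤ) else 0, 0, t) := by
    intro s t
    simpa using hmem s t 0 0 (by simp) (by simp)
  refine hU.not_isQIEmbedding
    (fun s t => ((fun l => if l = i then (s : ℝ) else 0, 0, t) : HeisReal n))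
    (fun s t => chainExists_one _ (hbase s t) ?_)
    (fun s t => chainExists_one _ (hbase s t) ?_) (2 * n + 1)
    (by linarith [n.cast_nonneg (α := ℝ)]) (fun m s t s' t' h => ⟨?_, ?_⟩) f
  · convert hmem s t (fun l => if l = i then 1 else 0) 0 (fun l => by split_ifs <;> simp)
      (by simp) using 3
    · split_ifs <;> simp
    · simp
  · convert hmem s t 0 1 (by simp) (by simp) using 3
    · simp
    · simp
  · simpa using h.abs_sub_le (fun p => p.1 i) fun γ p hp q hq => (heisCover_sub_le hp hq).1 i
  · simpa using h.heisCover_le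

theorem exists_chainExists_uniformCovering_one (x y : Fin 1 → ℝ) :
    ∃ k, ChainExists (uniformCovering 1) k x y := by
  have hfloor : ∀ x : Fin 1 → ℝ, ChainExists (uniformCovering 1) 1 (fun _ => (⌊x 0⌋ : ℝ)) x :=
    fun x => chainExists_one (fun _ => ⌊x 0⌋) (fun i => by simp) fun i => by
      rw [Subsingleton.elim i 0]
      exact ⟨Int.floor_le _, (Int.lt_floor_add_one _).le⟩
  have hint : ∀ m : ℤ, ∃ k, ChainExists (uniformCovering 1) k (fun _ => ((0 : ℤ) : ℝ))
      (fun _ => (m : ℝ)) := by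
    have hstep : ∀ m : ℤ, ChainExists (uniformCovering 1) 1 (fun _ => (m : ℝ))
        (fun _ => ((m + 1 : ℤ) : ℝ)) := fun m =>
      chainExists_one (fun _ => m) (fun i => by simp) (fun i => by simp)
    intro m
    induction m using Int.induction_on with
    | zero => exact ⟨_, (hstep 0).trans (hstep 0).symm⟩
    | succ m ih =>
      obtain ⟨k, hk⟩ := ih
      exact ⟨_, hk.trans (hstep m)⟩
    | pred m ih =>
      obtain ⟨k, hk⟩ := ih
      have := (hstep (-m - 1)).symm
      rw [sub_add_cancel] at this
      exact ⟨_, hk.trans this⟩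
  obtain ⟨k, hk⟩ := hint ⌊x 0⌋
  obtain ⟨l, hl⟩ := hint ⌊y 0⌋
  exact ⟨_, (((hfloor x).symm.trans hk.symm).trans hl).trans (hfloor y)⟩

/-- Pigeonhole: many points in an interval cannot have distinct integer parts. -/
theorem exists_floor_eq {r : ℝ} (hr : 0 ≤ r) {m : ℕ} (hm : 2 * r + 3 < m) (x : ℕ → ℝ)
    (hx : ∀ k < m, |x k - x 0| ≤ r) : ∃ k < m, ∃ l < m, k ≠ l ∧ ⌊x k⌋ = ⌊x l⌋ := by
  have hcard : (Finset.Icc ⌊x 0 - r⌋ ⌊x 0 + r⌋).card < (Finset.range m).card := by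
    rw [Int.card_Icc, Finset.card_range]
    have h1 := Int.floor_le (x 0 + r)
    have h2 := Int.lt_floor_add_one (x 0 - r)
    have h3 : ⌊x 0 + r⌋ + 1 - ⌊x 0 - r⌋ < (m : ℤ) := by
      have : ((⌊x 0 + r⌋ + 1 - ⌊x 0 - r⌋ : ℤ) : ℝ) < ((m : ℤ) : ℝ) := by
        push_cast
        linarith
      exact_mod_cast this
    have hm0 : 0 < m := by
      have : (0 : ℝ) < m := by linarith
      exact_mod_cast this
    omega
  obtain ⟨k, hk, l, hl, hkl, h⟩ := Finset.exists_ne_map_eq_of_card_lt_of_maps_to hcard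
    (f := fun k => ⌊x k⌋) (fun k hk => by
      have := abs_le.1 (hx k (by simpa using hk))
      simp only [Finset.coe_Icc, mem_Icc]
      exact ⟨Int.floor_le_floor (by linarith), Int.floor_le_floor (by linarith)⟩)
  exact ⟨k, by simpa using hk, l, by simpa using hl, hkl, h⟩

theorem not_isQuasiIsometry_uniformCovering_one {I₀ : Type*} {U : I₀ → Set SL2R}
    (hU : IsUniformCovering U) (f : (Fin 1 → ℝ) → SL2R) :
    ¬ IsQuasiIsometry (coveredDist (uniformCovering 1)) (coveredDist U) f := by
  rintro ⟨⟨L, C, hL, hC, hf⟩, M, hM, hnet⟩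
  obtain ⟨D, hD, hDist⟩ := hU.exists_coveredDist_bounds
  set P : ℝ := D * (L + C) + 2 * (D * M) with hP
  set T : ℝ := 2 * Real.cosh P with hT
  set z : ℕ → ℍ := fun k => ⟨⟨k * T, 1⟩, one_pos⟩ with hz
  have hcosh : ∀ k l, Real.cosh (dist (z k) (z l)) = 1 + ((k : ℝ) - l) ^ 2 * T ^ 2 / 2 := by
    intro k l
    rw [cosh_dist']
    simp only [hz, UpperHalfPlane.re, UpperHalfPlane.im]
    ring
  choose x hx using fun k => hnet (toSL2R (z k))
  have hzx : ∀ k, dist (z k) (f (x k) • I) ≤ D * M := fun k => by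
    have := (hDist (toSL2R (z k)) (f (x k))).1
    rw [toSL2R_smul_I] at this
    exact this.trans (by gcongr; exact hx k)
  have hfar : ∀ k l, k ≠ l → ⌊x k 0⌋ ≠ ⌊x l 0⌋ := by
    intro k l hkl h
    have h1 : ChainExists (uniformCovering 1) 1 (x k) (x l) := by
      refine chainExists_one (fun _ => ⌊x k 0⌋) (fun i => ?_) (fun i => ?_) <;>
        rw [Subsingleton.elim i 0]
      · exact ⟨Int.floor_le _, (Int.lt_floor_add_one _).le⟩
      · rw [h]
        exact ⟨Int.floor_le _, (Int.lt_floor_add_one _).le⟩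
    have h2 : dist (f (x k) • I) (f (x l) • I) ≤ D * (L + C) := by
      refine (hDist _ _).1.trans ?_
      gcongr
      refine (hf _ _).2.trans ?_
      have := coveredDist_le h1
      gcongr
      exact mul_le_of_le_one_right hL.le (by simpa using this)
    have h3 : dist (z k) (z l) ≤ P := by
      have := dist_triangle4 (z k) (f (x k) • I) (f (x l) • I) (z l)
      rw [dist_comm (f (x l) • I) (z l)] at this
      linarith [hzx k, hzx l]
    have h4 : Real.cosh (dist (z k) (z l)) ≤ Real.cosh P := by
      rw [Real.cosh_le_cosh, abs_of_nonneg dist_nonneg]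
      exact h3.trans (le_abs_self P)
    have h5 : (1 : ℝ) ≤ ((k : ℝ) - l) ^ 2 := by
      have : (1 : ℤ) ≤ ((k : ℤ) - l) ^ 2 := by
        have : (k : ℤ) - l ≠ 0 := by omega
        have := sq_pos_of_ne_zero this
        omega
      exact_mod_cast this
    rw [hcosh] at h4
    nlinarith [mul_le_mul_of_nonneg_right h5 (sq_nonneg T), Real.one_le_cosh P]
  have hnear : ∀ j k : ℕ, k < 2 ^ j →
      dist (z k) (z 0) ≤ j * Real.log 4 + Real.log (2 + T ^ 2) := by
    intro j k hk
    have h1 : Real.exp (dist (z k) (z 0)) ≤ 4 ^ j * (2 + T ^ 2) := by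
      have h2 : (k : ℝ) ^ 2 ≤ 4 ^ j := by
        calc (k : ℝ) ^ 2 ≤ (2 ^ j) ^ 2 := by
              gcongr
              exact_mod_cast hk.le
          _ = 4 ^ j := by rw [← pow_mul, mul_comm, pow_mul]; norm_num
      have h3 := hcosh k 0
      rw [Real.cosh_eq] at h3
      have h4 := Real.exp_pos (-dist (z k) (z 0))
      have h5 : (1 : ℝ) ≤ 4 ^ j := one_le_pow₀ (by norm_num)
      push_cast at h3
      nlinarith [mul_le_mul_of_nonneg_right h2 (sq_nonneg T)]
    rw [← Real.log_pow, ← Real.log_mul (by positivity) (by positivity)]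
    exact (Real.le_log_iff_exp_le (by positivity)).2 h1
  have hclose : ∀ j k : ℕ, k < 2 ^ j → |x k 0 - x 0 0| ≤
      L * (D * (2 * (D * M) + (j * Real.log 4 + Real.log (2 + T ^ 2)) + 1) + C) + 1 := by
    intro j k hk
    obtain ⟨m, hm, hm'⟩ := exists_chainExists_le_coveredDist_add_one
      (exists_chainExists_uniformCovering_one (x k) (x 0))
    have h1 := hm.abs_sub_le (fun p => p 0) (abs_sub_le_one_of_mem_uniformCovering 0)
    refine h1.trans (hm'.trans ?_)
    gcongr
    rw [← div_le_iff₀' hL]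
    have h2 := (hf (x k) (x 0)).1
    have h3 := (hDist (f (x k)) (f (x 0))).2
    have h4 : dist (f (x k) • I) (f (x 0) • I) ≤
        2 * (D * M) + (j * Real.log 4 + Real.log (2 + T ^ 2)) := by
      have := dist_triangle4 (f (x k) • I) (z k) (z 0) (f (x 0) • I)
      rw [dist_comm (f (x k) • I) (z k)] at this
      linarith [hzx k, hzx 0, hnear j k hk]
    have h5 : D * (dist (f (x k) • I) (f (x 0) • I) + 1) ≤
        D * (2 * (D * M) + (j * Real.log 4 + Real.log (2 + T ^ 2)) + 1) := by gcongr
    rw [one_div_mul_eq_div] at h2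
    linarith
  obtain ⟨j, hj⟩ := exists_mul_add_pow_lt_two_pow (2 * (L * (D * Real.log 4)))
    (2 * (L * (D * (2 * (D * M) + Real.log (2 + T ^ 2) + 1) + C) + 1) + 3) 0
  obtain ⟨k, -, l, -, hkl, h⟩ := exists_floor_eq (m := 2 ^ j)
    ((abs_nonneg _).trans (hclose j 0 (by positivity)))
    (by push_cast; linarith) (fun k => x k 0) (hclose j)
  exact hfar k l hkl h

end Obstructions

/-- Let `U` be any uniform covering of `SL(2,ℝ)` with associated metric `d_U`.
Then: (i) for every `k ≥ 2` there is no quasi-isometric embedding from `(ℝᵏ, d_{U(ℝᵏ)})` to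
`(SL(2,ℝ), d_U)`; (ii) for every `n ≥ 1` there is no quasi-isometric embedding from
`(ℝ^{2n+1}, d_{P_n})` to `(SL(2,ℝ), d_U)`; (iii) `(ℝ, d_{U(ℝ)})` is not quasi-isometric to
`(SL(2,ℝ), d_U)`. -/
theorem statement15 {I : Type*} (U : I → Set SL2R) (hU : IsUniformCovering U) :
    (∀ k : ℕ, 2 ≤ k → ¬ ∃ f : (Fin k → ℝ) → SL2R,
        IsQIEmbedding (coveredDist (uniformCovering k)) (coveredDist U) f) ∧
    (∀ n : ℕ, 1 ≤ n → ¬ ∃ f : HeisReal n → SL2R,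
        IsQIEmbedding (coveredDist (heisCover n)) (coveredDist U) f) ∧
    ¬ ∃ f : (Fin 1 → ℝ) → SL2R,
        IsQuasiIsometry (coveredDist (uniformCovering 1)) (coveredDist U) f := by
  exact ⟨fun k hk ⟨f, hf⟩ => not_isQIEmbedding_uniformCovering hU hk f hf,
    fun n hn ⟨f, hf⟩ => not_isQIEmbedding_heisCover hU hn f hf,
    fun ⟨f, hf⟩ => not_isQuasiIsometry_uniformCovering_one hU f hf⟩
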